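/- arXiv:2406.18902 — 2 statements merged into one kernel-verified Lean document; each statement's English description precedes it below -/
import Mathlib

section
/- Let τ > 0, let ν be the one-dimensional Gaussian distribution N(0, τ²), and let Z ⊆ ℝ be a measurable set with ν(Z) > 0. Let ν_Z denote ν conditioned on Z (the truncated normal TN(0, τ², Z)), and define the selective p-value map p : ℝ → ℝ by p(t) = ν_Z({x ∈ ℝ : |x| ≥ |t|}) = ν(Z ∩ {x : |x| ≥ |t|})/ν(Z). Then the pushforward of ν_Z under p is the uniform distribution on [0,1]. -/
open MeasureTheory ProbabilityTheory

/-- The cumulative distribution function of a measure without point masses is continuous. -/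
lemma continuous_cdf_of_measure_singleton_eq_zero (μ : Measure ℝ) [IsProbabilityMeasure μ]
    (hμ : ∀ x, μ {x} = 0) : Continuous (cdf μ) := by
  refine continuous_iff_continuousAt.2 fun x => ?_
  rw [(monotone_cdf μ).continuousAt_iff_leftLim_eq_rightLim, StieltjesFunction.rightLim_eq]
  refine le_antisymm ((monotone_cdf μ).leftLim_le le_rfl) ?_
  have h := (cdf μ).measure_singleton x
  rw [measure_cdf, hμ, eq_comm, ENNReal.ofReal_eq_zero] at h
  linarith

/-- Each value in `(0, 1)` of a continuous cumulative distribution function is the probability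
of the corresponding sublevel set. -/
lemma measure_cdf_le_of_mem_Ioo (μ : Measure ℝ) [IsProbabilityMeasure μ]
    (hμ : Continuous (cdf μ)) {u : ℝ} (hu : u ∈ Set.Ioo (0 : ℝ) 1) :
    μ {x | cdf μ x ≤ u} = ENNReal.ofReal u := by
  obtain ⟨l, hl⟩ := ((tendsto_cdf_atBot μ).eventually (gt_mem_nhds hu.1)).exists
  obtain ⟨r, hr⟩ := ((tendsto_cdf_atTop μ).eventually (lt_mem_nhds hu.2)).exists
  obtain ⟨a, ha⟩ : ∃ a, cdf μ a = u := mem_range_of_exists_le_of_exists_ge hμ ⟨l, hl.le⟩ ⟨r, hr.le⟩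
  have hbdd : BddAbove {x | cdf μ x ≤ u} :=
    ⟨r, fun x hx => le_of_not_ge fun hrx => not_le.2 hr (((monotone_cdf μ) hrx).trans hx)⟩
  have hmem : cdf μ (sSup {x | cdf μ x ≤ u}) ≤ u :=
    (isClosed_le hμ continuous_const).csSup_mem ⟨a, ha.le⟩ hbdd
  have hset : {x | cdf μ x ≤ u} = Set.Iic (sSup {x | cdf μ x ≤ u}) :=
    Set.Subset.antisymm (fun x hx => le_csSup hbdd hx)
      fun x hx => (monotone_cdf μ hx).trans hmem
  have heq : cdf μ (sSup {x | cdf μ x ≤ u}) = u :=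
    le_antisymm hmem (ha.symm.le.trans (monotone_cdf μ (le_csSup hbdd ha.le)))
  rw [hset, ← ofReal_cdf, heq]

/-- The probability integral transform. -/
lemma map_cdf_eq_volume_restrict_Icc (μ : Measure ℝ) [IsProbabilityMeasure μ]
    (hμ : Continuous (cdf μ)) :
    μ.map (cdf μ) = volume.restrict (Set.Icc (0 : ℝ) 1) := by
  have : IsProbabilityMeasure (μ.map (cdf μ)) :=
    Measure.isProbabilityMeasure_map hμ.measurable.aemeasurable
  refine Measure.ext_of_Iic _ _ fun u => ?_
  rw [Measure.map_apply hμ.measurable measurableSet_Iic, Measure.restrict_apply measurableSet_Iic]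
  change μ {x | cdf μ x ≤ u} = _
  rcases le_or_gt u 0 with h0 | h0
  · have hz : volume (Set.Iic u ∩ Set.Icc (0 : ℝ) 1) = 0 :=
      measure_mono_null (t := {0}) (fun x hx => le_antisymm (hx.1.trans h0) hx.2.1) (by simp)
    rw [hz, ← nonpos_iff_eq_zero]
    have hlim : Filter.Tendsto (fun ε : ℝ => ENNReal.ofReal ε) (nhdsWithin 0 (Set.Ioi 0))
        (nhds 0) := by
      simpa using (ENNReal.continuous_ofReal.tendsto 0).mono_left nhdsWithin_le_nhds
    refine ge_of_tendsto hlim ?_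
    filter_upwards [Ioo_mem_nhdsGT (zero_lt_one' ℝ)] with ε hε
    rw [← measure_cdf_le_of_mem_Ioo μ hμ hε]
    exact measure_mono fun x hx => le_trans hx (h0.trans hε.1.le)
  rcases lt_or_ge u 1 with h1 | h1
  · rw [measure_cdf_le_of_mem_Ioo μ hμ ⟨h0, h1⟩]
    have : Set.Iic u ∩ Set.Icc (0 : ℝ) 1 = Set.Icc 0 u := by
      ext x
      simp only [Set.mem_inter_iff, Set.mem_Iic, Set.mem_Icc]
      grind
    rw [this, Real.volume_Icc, sub_zero]
  · have hl : {x | cdf μ x ≤ u} = Set.univ :=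
      Set.eq_univ_of_forall fun x => (cdf_le_one μ x).trans h1
    rw [hl, measure_univ, Set.inter_eq_right.2 fun x hx => hx.2.trans h1]
    simp

/-- The two-sided p-value `t ↦ μ {x | |t| ≤ |x|}` of a probability measure without point masses
is uniformly distributed on `[0, 1]`. -/
lemma map_measure_abs_ge_eq_volume_restrict_Icc (μ : Measure ℝ) [IsProbabilityMeasure μ]
    (hμ : ∀ x, μ {x} = 0) :
    μ.map (fun t : ℝ => (μ {x : ℝ | |t| ≤ |x|}).toReal) =
      volume.restrict (Set.Icc (0 : ℝ) 1) := by
  have hm : Measurable fun x : ℝ => -|x| := by fun_prop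
  have : IsProbabilityMeasure (μ.map fun x : ℝ => -|x|) :=
    Measure.isProbabilityMeasure_map hm.aemeasurable
  have hnull : ∀ y, (μ.map fun x : ℝ => -|x|) {y} = 0 := fun y => by
    rw [Measure.map_apply hm (measurableSet_singleton y)]
    refine measure_mono_null (t := {y} ∪ {-y}) (fun x hx => ?_)
      (measure_union_null (hμ y) (hμ (-y)))
    have hx' : -|x| = y := hx
    simp only [Set.mem_union, Set.mem_singleton_iff]
    rcases abs_choice x with h | h <;> grind
  have hcont := continuous_cdf_of_measure_singleton_eq_zero _ hnull
  have hp : (fun t : ℝ => (μ {x : ℝ | |t| ≤ |x|}).toReal) =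
      cdf (μ.map fun x : ℝ => -|x|) ∘ fun x : ℝ => -|x| := by
    funext t
    rw [Function.comp_apply, cdf_eq_real, Measure.real, Measure.map_apply hm measurableSet_Iic]
    congr 2
    ext x
    simp
  rw [hp, ← Measure.map_map hcont.measurable hm, map_cdf_eq_volume_restrict_Icc _ hcont]

/-- under the null (mean zero), the selective p-value computed from the
truncated normal `TN(0, τ², Z)` (the Gaussian `N(0, τ²)` conditioned on a measurable set
`Z` of positive measure) is uniformly distributed on `[0,1]`: the pushforward of the
truncated normal under `p(t) = ν_Z {x : |x| ≥ |t|}` is the uniform distribution. -/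
theorem statement_8 (τ : ℝ) (hτ : 0 < τ) (Z : Set ℝ) (hZm : MeasurableSet Z)
    (hZ : 0 < gaussianReal 0 (Real.toNNReal (τ ^ 2)) Z) :
    let ν : Measure ℝ := gaussianReal 0 (Real.toNNReal (τ ^ 2))
    let νZ : Measure ℝ := ν[|Z]
    νZ.map (fun t : ℝ => (νZ {x : ℝ | |t| ≤ |x|}).toReal) =
      volume.restrict (Set.Icc (0 : ℝ) 1) := by
  intro ν νZ
  have : IsProbabilityMeasure νZ := cond_isProbabilityMeasure hZ.ne'
  have hv : Real.toNNReal (τ ^ 2) ≠ 0 := (Real.toNNReal_pos.2 (pow_pos hτ 2)).ne'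
  have := nullSingletonClass_gaussianReal (μ := 0) hv
  exact map_measure_abs_ge_eq_volume_restrict_Icc νZ fun x =>
    cond_absolutelyContinuous (measure_singleton x)
end

section
/- Let X ∈ ℝ^{n×d} with X^TX invertible, y ∈ ℝ^n, β̂ = (X^TX)^{-1}X^Ty the least-squares coefficients, H = X(X^TX)^{-1}X^T the hat matrix with leverage h_ii = H_ii, and ε̂ = y - Xβ̂ the residual vector; assume h_ii ≠ 1, and let β̂_{(i)} = (X_{(i)}^TX_{(i)})^{-1}X_{(i)}^Ty_{(i)} be the least-squares coefficients computed after deleting the i-th instance. Then β̂ - β̂_{(i)} = (X^TX)^{-1} x_i ε̂_i/(1 - h_ii). -/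
open Matrix

/-- Deleting row `i` subtracts a rank-one term from the Gram matrix. -/
lemma gram_submatrix_succAbove_mulVec {n d : ℕ} (X : Matrix (Fin (n + 1)) (Fin d) ℝ)
    (i : Fin (n + 1)) (v : Fin d → ℝ) :
    ((X.submatrix i.succAbove id)ᵀ * X.submatrix i.succAbove id) *ᵥ v =
      (Xᵀ * X) *ᵥ v - (X i ⬝ᵥ v) • X i := by
  rw [← mulVec_mulVec, ← mulVec_mulVec]
  ext j
  have h := Fin.sum_univ_succAbove (fun k => X k j * (X k ⬝ᵥ v)) i
  simp only [mulVec, dotProduct, transpose_apply, submatrix_apply, id_eq, Pi.sub_apply,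
    Pi.smul_apply, smul_eq_mul] at h ⊢
  rw [h]
  ring

/-- Deleting row `i` from `X` and entry `i` from `y` removes one term of `Xᵀ y`. -/
lemma transpose_submatrix_succAbove_mulVec {n d : ℕ} (X : Matrix (Fin (n + 1)) (Fin d) ℝ)
    (i : Fin (n + 1)) (y : Fin (n + 1) → ℝ) :
    (X.submatrix i.succAbove id)ᵀ *ᵥ (y ∘ i.succAbove) = Xᵀ *ᵥ y - y i • X i := by
  ext j
  have h := Fin.sum_univ_succAbove (fun k => X k j * y k) i
  simp only [mulVec, dotProduct, transpose_apply, submatrix_apply, id_eq, Pi.sub_apply,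
    Pi.smul_apply, smul_eq_mul, Function.comp_apply] at h ⊢
  rw [h]
  ring

/-- A diagonal entry of `X M Xᵀ` is the bilinear form of `M` at a row of `X`. -/
lemma mul_mul_transpose_diag_eq_dotProduct {m d : Type*} [Fintype d]
    (X : Matrix m d ℝ) (M : Matrix d d ℝ)
    (i : m) : (X * M * Xᵀ) i i = X i ⬝ᵥ (M *ᵥ X i) := by
  rw [Matrix.mul_assoc, mul_apply]
  rfl

/-- The leave-one-out Gram matrix is invertible when the leverage is not `1`. -/
lemma isUnit_gram_submatrix_succAbove {n d : ℕ} (X : Matrix (Fin (n + 1)) (Fin d) ℝ)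
    (hG : IsUnit (Xᵀ * X)) (i : Fin (n + 1))
    (hh : X i ⬝ᵥ ((Xᵀ * X)⁻¹ *ᵥ X i) ≠ 1) :
    IsUnit ((X.submatrix i.succAbove id)ᵀ * X.submatrix i.succAbove id) := by
  have hdet := (isUnit_iff_isUnit_det _).1 hG
  rw [← mulVec_injective_iff_isUnit]
  refine (injective_iff_map_eq_zero (mulVecLin _)).2 fun v hv => ?_
  rw [mulVecLin_apply, gram_submatrix_succAbove_mulVec, sub_eq_zero] at hv
  have hv' : v = (X i ⬝ᵥ v) • ((Xᵀ * X)⁻¹ *ᵥ X i) := by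
    rw [← mulVec_smul, ← hv, mulVec_mulVec, nonsing_inv_mul _ hdet, one_mulVec]
  have hx := congrArg (X i ⬝ᵥ ·) hv'
  simp only [dotProduct_smul, smul_eq_mul] at hx
  have h0 : X i ⬝ᵥ v = 0 := by
    by_contra hne
    exact hh (mul_left_cancel₀ hne (by rw [← hx, mul_one]))
  rw [hv', h0, zero_smul]

/-- leave-one-out change of the least-squares coefficients:
`β̂ - β̂₍ᵢ₎ = (XᵀX)⁻¹ xᵢ ε̂ᵢ / (1 - hᵢᵢ)`. -/
theorem statement_10 (n d : ℕ) (X : Matrix (Fin (n + 1)) (Fin d) ℝ) (y : Fin (n + 1) → ℝ)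
    (hG : IsUnit (Xᵀ * X)) (i : Fin (n + 1))
    (hh : (X * (Xᵀ * X)⁻¹ * Xᵀ) i i ≠ 1) :
    let G : Matrix (Fin d) (Fin d) ℝ := Xᵀ * X
    let βhat : Fin d → ℝ := G⁻¹ *ᵥ (Xᵀ *ᵥ y)
    let h : ℝ := (X * G⁻¹ * Xᵀ) i i
    let εhat : Fin (n + 1) → ℝ := y - X *ᵥ βhat
    let Xdel : Matrix (Fin n) (Fin d) ℝ := X.submatrix i.succAbove id
    let ydel : Fin n → ℝ := y ∘ i.succAbove
    let βdel : Fin d → ℝ := (Xdelᵀ * Xdel)⁻¹ *ᵥ (Xdelᵀ *ᵥ ydel)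
    βhat - βdel = (εhat i / (1 - h)) • (G⁻¹ *ᵥ X i) := by
  intro G βhat h εhat Xdel ydel βdel
  have hdet : IsUnit G.det := (isUnit_iff_isUnit_det _).1 hG
  have hq : X i ⬝ᵥ (G⁻¹ *ᵥ X i) = h := (mul_mul_transpose_diag_eq_dotProduct X G⁻¹ i).symm
  have hA : IsUnit (Xdelᵀ * Xdel) :=
    isUnit_gram_submatrix_succAbove X hG i (by rwa [← mul_mul_transpose_diag_eq_dotProduct])
  have hdetA := (isUnit_iff_isUnit_det _).1 hA
  have h1 : 1 - h ≠ 0 := sub_ne_zero.2 (Ne.symm hh)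
  have hGinv (v : Fin d → ℝ) : (Xᵀ * X) *ᵥ (G⁻¹ *ᵥ v) = v := by
    rw [mulVec_mulVec, mul_nonsing_inv _ hdet, one_mulVec]
  have hε : εhat i = y i - X i ⬝ᵥ βhat := rfl
  apply mulVec_injective_iff_isUnit.2 hA
  change (Xdelᵀ * Xdel) *ᵥ (βhat - βdel) = (Xdelᵀ * Xdel) *ᵥ _
  have hβdel : (Xdelᵀ * Xdel) *ᵥ βdel = Xᵀ *ᵥ y - y i • X i := by
    rw [mulVec_mulVec, mul_nonsing_inv _ hdetA, one_mulVec,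
      transpose_submatrix_succAbove_mulVec]
  rw [mulVec_sub, hβdel, mulVec_smul, gram_submatrix_succAbove_mulVec,
    gram_submatrix_succAbove_mulVec, hGinv, hGinv, hq, hε]
  ext j
  simp only [Pi.sub_apply, Pi.smul_apply, smul_eq_mul]
  field_simp
  ring
end
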